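/- arXiv:2504.14099 — 5 statements merged into one kernel-verified Lean document; each statement's English description precedes it below -/
import Mathlib

section
/- Every leading principal submatrix of a symmetric quasidefinite matrix is nonsingular. That is, if K = [[E, Fᵀ],[F, −G]] ∈ ℝ^{(n+m)×(n+m)} with E ∈ ℝ^{n×n} symmetric positive definite, G ∈ ℝ^{m×m} symmetric positive definite, and F ∈ ℝ^{m×n} arbitrary, then for every k with 1 ≤ k ≤ n+m, the k×k leading principal submatrix of K (the submatrix formed by the first k rows and first k columns) is invertible. -/
open Matrix

theorem Matrix.PosDef.fromBlocks_diagonal {m n : Type*} [Fintype m] [Fintype n]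
    {A : Matrix m m ℝ} {D : Matrix n n ℝ} (hA : A.PosDef) (hD : D.PosDef) :
    (fromBlocks A 0 0 D).PosDef := by
  refine .of_dotProduct_mulVec_pos
    (isHermitian_fromBlocks_iff.mpr ⟨hA.isHermitian, by simp, by simp, hD.isHermitian⟩)
    fun x hx => ?_
  obtain ⟨u, v, rfl⟩ : ∃ u v, x = Sum.elim u v := ⟨_, _, (Sum.elim_comp_inl_inr x).symm⟩
  have hu := hA.posSemidef.dotProduct_mulVec_nonneg u
  have hv := hD.posSemidef.dotProduct_mulVec_nonneg v
  simp only [star_trivial] at hu hv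
  simp only [star_trivial, fromBlocks_mulVec, Sum.elim_comp_inl, Sum.elim_comp_inr, zero_mulVec,
    add_zero, zero_add, sumElim_dotProduct_sumElim]
  by_cases h : u = 0
  · have hv0 : v ≠ 0 := by
      rintro rfl
      exact hx (by simp [h])
    exact add_pos_of_nonneg_of_pos hu (by simpa using hD.dotProduct_mulVec_pos hv0)
  · exact add_pos_of_pos_of_nonneg (by simpa using hA.dotProduct_mulVec_pos h) hv

/-- A real square matrix with positive definite symmetric part is invertible. -/
theorem Matrix.isUnit_of_posDef_add_transpose {n : Type*} [Fintype n] [DecidableEq n]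
    {A : Matrix n n ℝ} (hA : (A + Aᵀ).PosDef) : IsUnit A := by
  rw [isUnit_iff_isUnit_det, isUnit_iff_ne_zero]
  intro hdet
  obtain ⟨x, hx, hAx⟩ := exists_mulVec_eq_zero_iff.mpr hdet
  have h := hA.dotProduct_mulVec_pos hx
  rw [add_mulVec, hAx, zero_add, mulVec_transpose, dotProduct_comm, star_trivial,
    ← dotProduct_mulVec, hAx, dotProduct_zero] at h
  exact h.false

/-- Every principal submatrix of a symmetric quasidefinite matrix is invertible. -/
theorem Matrix.isUnit_submatrix_fromBlocks_quasidefinite {m n ι : Type*}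
    [Fintype m] [Fintype n] [Fintype ι] [DecidableEq m] [DecidableEq n] [DecidableEq ι]
    {E : Matrix n n ℝ} {G : Matrix m m ℝ} (F : Matrix m n ℝ) (hE : E.PosDef) (hG : G.PosDef)
    {e : ι → n ⊕ m} (he : Function.Injective e) :
    IsUnit ((fromBlocks E Fᵀ F (-G)).submatrix e e) := by
  have hsym : fromBlocks E Fᵀ (-F) G + (fromBlocks E Fᵀ (-F) G)ᵀ =
      fromBlocks (E + E) 0 0 (G + G) := by
    have hEt : Eᵀ = E := by simpa using hE.isHermitian.eq
    have hGt : Gᵀ = G := by simpa using hG.isHermitian.eq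
    simp [fromBlocks_transpose, fromBlocks_add, hEt, hGt]
  have hunit : IsUnit ((fromBlocks E Fᵀ (-F) G).submatrix e e) := by
    apply isUnit_of_posDef_add_transpose
    have h := ((hE.add hE).fromBlocks_diagonal (hG.add hG)).submatrix he
    rwa [← hsym] at h
  have hmul : (fromBlocks E Fᵀ (-F) G).submatrix e e =
      diagonal (Sum.elim 1 (-1) ∘ e) * (fromBlocks E Fᵀ F (-G)).submatrix e e := by
    ext i j
    rw [diagonal_mul]
    rcases hi : e i with a | a <;> rcases hj : e j with b | b <;> simp [hi, hj]
  rw [hmul, isUnit_iff_isUnit_det, det_mul] at hunit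
  exact (isUnit_iff_isUnit_det _).mpr (isUnit_of_mul_isUnit_right hunit)

/-- Every leading principal submatrix of a symmetric quasidefinite matrix
`[[E, Fᵀ],[F, -G]]` (reindexed over `Fin (n + m)` so that the first `n` indices
correspond to the `E` block) is invertible. -/
theorem quasidefinite_leading_principal_submatrix_nonsingular {n m : ℕ}
    (E : Matrix (Fin n) (Fin n) ℝ) (G : Matrix (Fin m) (Fin m) ℝ)
    (F : Matrix (Fin m) (Fin n) ℝ)
    (hE : E.PosDef) (hG : G.PosDef)
    (k : ℕ) (hk1 : 1 ≤ k) (hk2 : k ≤ n + m) :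
    IsUnit
      (((Matrix.fromBlocks E Fᵀ F (-G)).submatrix
          (⇑finSumFinEquiv.symm) (⇑finSumFinEquiv.symm)).submatrix
        (Fin.castLE hk2) (Fin.castLE hk2)) := by
  rw [submatrix_submatrix]
  exact isUnit_submatrix_fromBlocks_quasidefinite F hE hG
    (finSumFinEquiv.symm.injective.comp (Fin.castLE_injective hk2))
end

section
/- Every symmetric quasidefinite matrix admits an LDLᵀ factorization with sign-definite pivots: if K = [[E, Fᵀ],[F, −G]] ∈ ℝ^{(n+m)×(n+m)} with E ∈ ℝ^{n×n} symmetric positive definite, G ∈ ℝ^{m×m} symmetric positive definite, and F ∈ ℝ^{m×n} arbitrary, then there exist a unit lower triangular matrix L ∈ ℝ^{(n+m)×(n+m)} (lower triangular with ones on the diagonal) and a diagonal matrix D ∈ ℝ^{(n+m)×(n+m)} such that K = L D Lᵀ, where the first n diagonal entries of D are positive and the last m diagonal entries of D are negative. -/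
open Matrix

/-- Each Gram-Schmidt vector of a basis has coordinate `1` along its own basis vector. -/
theorem InnerProductSpace.gramSchmidt_repr_self {𝕜 V ι : Type*} [RCLike 𝕜]
    [NormedAddCommGroup V] [InnerProductSpace 𝕜 V] [LinearOrder ι] [LocallyFiniteOrderBot ι]
    [WellFoundedLT ι] (b : Module.Basis ι 𝕜 V) (i : ι) :
    b.repr (gramSchmidt 𝕜 b i) i = 1 := by
  have h := congrArg (fun v => b.repr v i) (gramSchmidt_def 𝕜 b i)
  simp only [map_sub, map_sum, Finsupp.sub_apply, Finsupp.finsetSum_apply,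
    Submodule.starProjection_singleton, map_smul, Finsupp.smul_apply, Module.Basis.repr_self,
    Finsupp.single_eq_same] at h
  rw [h, Finset.sum_eq_zero, sub_zero]
  intro j hj
  rw [gramSchmidt_triangular (Finset.mem_Iio.mp hj) b, smul_zero]

open scoped ComplexOrder in
/-- The Gram-Schmidt matrix `LDL.lowerInv` has unit diagonal. -/
theorem LDL.lowerInv_apply_self {𝕜 n : Type*} [RCLike 𝕜] [LinearOrder n] [WellFoundedLT n]
    [LocallyFiniteOrderBot n] [Fintype n] {S : Matrix n n 𝕜} (hS : S.PosDef) (i : n) :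
    LDL.lowerInv hS i i = 1 := by
  rw [← @InnerProductSpace.gramSchmidt_repr_self 𝕜 (n → 𝕜) n _
      (Sᵀ.toNormedAddCommGroup hS.transpose)
      (Sᵀ.toInnerProductSpace hS.transpose.posSemidef) _ _ _ (Pi.basisFun 𝕜 n) i,
    Pi.basisFun_repr, LDL.lowerInv]

/-- A real positive definite matrix has an `LDLᵀ` factorization with `L` unit lower triangular
and positive pivots. -/
theorem Matrix.PosDef.exists_unit_lower_mul_diagonal_mul_transpose {n : Type*} [LinearOrder n]
    [WellFoundedLT n] [LocallyFiniteOrderBot n] [Fintype n] {S : Matrix n n ℝ} (hS : S.PosDef) :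
    ∃ (L : Matrix n n ℝ) (d : n → ℝ), (∀ i, L i i = 1) ∧ (∀ i j, i < j → L i j = 0) ∧
      (∀ i, 0 < d i) ∧ S = L * diagonal d * Lᵀ := by
  have hlow : (LDL.lowerInv hS).BlockTriangular OrderDual.toDual :=
    fun i j hij => LDL.lowerInv_triangular hS (OrderDual.toDual_lt_toDual.mp hij)
  have hlow' : (LDL.lower hS).BlockTriangular OrderDual.toDual :=
    blockTriangular_inv_of_blockTriangular hlow
  have hzero : ∀ i j, i < j → LDL.lower hS i j = 0 :=
    fun i j hij => hlow' (OrderDual.toDual_lt_toDual.mpr hij)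
  refine ⟨LDL.lower hS, LDL.diagEntries hS, fun i => ?_, hzero, fun i => ?_, ?_⟩
  · have h : (LDL.lower hS * LDL.lowerInv hS) i i = 1 := by
      rw [LDL.lower, inv_mul_of_invertible, one_apply_eq]
    rw [mul_apply, Finset.sum_eq_single i, LDL.lowerInv_apply_self, mul_one] at h
    · exact h
    · intro j _ hj
      rcases hj.lt_or_gt with hj | hj
      · rw [LDL.lowerInv_triangular hS hj, mul_zero]
      · rw [hzero i j hj, zero_mul]
    · simp
  · have h : (LDL.diag hS).PosDef := by
      rw [LDL.diag_eq_lowerInv_conj]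
      exact hS.mul_mul_conjTranspose_same
        (vecMul_injective_of_isUnit (isUnit_of_invertible (LDL.lowerInv hS)))
    exact posDef_diagonal_iff.mp h i
  · exact (LDL.lower_conj_diag hS).symm

/-- Block `LDLᵀ` factorization: factorizations of the leading block and of its Schur complement
combine into one of the whole symmetric matrix. -/
theorem Matrix.fromBlocks_eq_mul_diagonal_mul_transpose {n m R : Type*} [Fintype n] [Fintype m]
    [DecidableEq n] [DecidableEq m] [CommRing R] {A L₁ : Matrix n n R} {S L₂ : Matrix m m R}
    (F : Matrix m n R) {d₁ : n → R} {d₂ : m → R} (hA : IsUnit A)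
    (h₁ : A = L₁ * diagonal d₁ * L₁ᵀ) (h₂ : S = L₂ * diagonal d₂ * L₂ᵀ) :
    fromBlocks A Fᵀ F (F * A⁻¹ * Fᵀ + S) =
      fromBlocks L₁ 0 (F * A⁻¹ * L₁) L₂ * diagonal (Sum.elim d₁ d₂) *
        (fromBlocks L₁ 0 (F * A⁻¹ * L₁) L₂)ᵀ := by
  have hdet := (isUnit_iff_isUnit_det A).mp hA
  have hsymm : Aᵀ = A := by
    rw [h₁]
    simp [Matrix.mul_assoc]
  have hlower : F * A⁻¹ * L₁ * diagonal d₁ * L₁ᵀ = F := by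
    rw [Matrix.mul_assoc, Matrix.mul_assoc, ← Matrix.mul_assoc L₁, ← h₁,
      nonsing_inv_mul_cancel_right _ _ hdet]
  have hupper : L₁ * diagonal d₁ * (F * A⁻¹ * L₁)ᵀ = Fᵀ := by
    have h := congrArg transpose hlower
    simpa [Matrix.mul_assoc] using h
  have hcorner : F * A⁻¹ * L₁ * diagonal d₁ * (F * A⁻¹ * L₁)ᵀ = F * A⁻¹ * Fᵀ := by
    rw [Matrix.mul_assoc, Matrix.mul_assoc (F * A⁻¹), ← Matrix.mul_assoc L₁, hupper]
  rw [← fromBlocks_diagonal, fromBlocks_transpose, fromBlocks_multiply, fromBlocks_multiply]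
  simp only [Matrix.mul_zero, Matrix.zero_mul, transpose_zero, add_zero, zero_add]
  rw [hlower, hupper, hcorner, ← h₁, ← h₂]

/-- Every symmetric quasidefinite matrix admits an LDLᵀ factorization with
sign-definite pivots: `K = L D Lᵀ` with `L` unit lower triangular and `D`
diagonal, where the first `n` diagonal entries of `D` are positive and the
last `m` diagonal entries are negative.  The quasidefinite matrix
`[[E, Fᵀ],[F, -G]]` is reindexed over `Fin (n + m)` so that the first `n`
indices correspond to the `E` block. -/
theorem quasidefinite_ldl_factorization {n m : ℕ}
    (E : Matrix (Fin n) (Fin n) ℝ) (G : Matrix (Fin m) (Fin m) ℝ)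
    (F : Matrix (Fin m) (Fin n) ℝ)
    (hE : E.PosDef) (hG : G.PosDef) :
    ∃ L D : Matrix (Fin (n + m)) (Fin (n + m)) ℝ,
      (∀ i, L i i = 1) ∧
      (∀ i j : Fin (n + m), i < j → L i j = 0) ∧
      (∀ i j : Fin (n + m), i ≠ j → D i j = 0) ∧
      (Matrix.fromBlocks E Fᵀ F (-G)).submatrix
          (⇑finSumFinEquiv.symm) (⇑finSumFinEquiv.symm) = L * D * Lᵀ ∧
      (∀ i : Fin (n + m), (i : ℕ) < n → 0 < D i i) ∧
      (∀ i : Fin (n + m), n ≤ (i : ℕ) → D i i < 0) := by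
  obtain ⟨L₁, d₁, hone₁, hlow₁, hpos₁, h₁⟩ := hE.exists_unit_lower_mul_diagonal_mul_transpose
  have hS : (G + F * E⁻¹ * Fᵀ).PosDef :=
    hG.add_posSemidef (hE.inv.posSemidef.mul_mul_conjTranspose_same F)
  obtain ⟨L₂, d₂, hone₂, hlow₂, hpos₂, h₂⟩ := hS.exists_unit_lower_mul_diagonal_mul_transpose
  have hneg : -(G + F * E⁻¹ * Fᵀ) = L₂ * diagonal (-d₂) * L₂ᵀ := by
    rw [h₂, show diagonal (-d₂) = -diagonal d₂ from (diagonal_neg d₂).symm, Matrix.mul_neg,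
      Matrix.neg_mul]
  have hK := fromBlocks_eq_mul_diagonal_mul_transpose F hE.isUnit h₁ hneg
  rw [show F * E⁻¹ * Fᵀ + -(G + F * E⁻¹ * Fᵀ) = -G by abel] at hK
  refine ⟨(fromBlocks L₁ 0 (F * E⁻¹ * L₁) L₂).submatrix finSumFinEquiv.symm finSumFinEquiv.symm,
    (diagonal (Sum.elim d₁ (-d₂))).submatrix finSumFinEquiv.symm finSumFinEquiv.symm,
    ?_, ?_, ?_, ?_, ?_, ?_⟩
  · intro i
    induction i using Fin.addCases <;> simp [hone₁, hone₂]
  · intro i j hij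
    induction i using Fin.addCases with
    | left i =>
      induction j using Fin.addCases with
      | left j => simpa using hlow₁ i j hij
      | right j => simp
    | right i =>
      induction j using Fin.addCases with
      | left j =>
        rw [Fin.lt_def, Fin.val_natAdd, Fin.val_castAdd] at hij
        omega
      | right j => simpa using hlow₂ i j (by simpa using hij)
  · intro i j hij
    simp [hij]
  · rw [hK, transpose_submatrix, submatrix_mul_equiv, submatrix_mul_equiv]
  · intro i hi
    induction i using Fin.addCases with
    | left i => simpa using hpos₁ i
    | right i => simp at hi
  · intro i hi
    induction i using Fin.addCases with
    | left i => exact absurd hi (by simp)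
    | right i => simpa using hpos₂ i
end

section
/- Iterative refinement with a regularized matrix converges geometrically: let K ∈ ℝ^{N×N} be symmetric and invertible, let J = diag(I_n, −I_m) with n + m = N, let ε > 0, and suppose K^ε = K + εJ is invertible. Let r ∈ ℝ^N, initialize z₀ = (K^ε)⁻¹ r, and define z_{i+1} = z_i + (K^ε)⁻¹(r − K z_i) for i = 0, 1, …. Then for every N_ref ≥ 0, ‖z_{N_ref} − K⁻¹r‖₂ ≤ (ε‖(K^ε)⁻¹‖)^{N_ref + 1} ‖K⁻¹r‖₂, where ‖·‖ denotes the operator norm induced by the Euclidean norm. In particular, if ε‖(K^ε)⁻¹‖ < 1 then z_i → K⁻¹r as i → ∞. -/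
open Matrix Filter

/-- One step of the residual correction `v ↦ v - P A v`, where `P` is a left inverse of the
perturbation `A + ε J` of `A` by a multiple of a contraction `J`. -/
theorem norm_sub_apply_apply_le {E : Type*} [NormedAddCommGroup E] [NormedSpace ℝ E]
    {A J P : E →L[ℝ] E} {ε : ℝ} (hε : 0 ≤ ε) (hJ : ∀ v, ‖J v‖ ≤ ‖v‖)
    (hP : P * (A + ε • J) = 1) (v : E) :
    ‖v - P (A v)‖ ≤ ε * ‖P‖ * ‖v‖ := by
  have hv : v - P (A v) = ε • P (J v) := by
    have h := congrArg (fun T : E →L[ℝ] E => T v) hP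
    simp only [mul_apply_eq_comp, _root_.add_apply,
      _root_.smul_apply, map_add, map_smul, one_apply_eq_self] at h
    rw [sub_eq_iff_eq_add', h]
  calc ‖v - P (A v)‖ = ε * ‖P (J v)‖ := by rw [hv, norm_smul, Real.norm_of_nonneg hε]
    _ ≤ ε * (‖P‖ * ‖v‖) := by
      gcongr
      exact P.le_opNorm_of_le (hJ v)
    _ = ε * ‖P‖ * ‖v‖ := by ring

theorem norm_toEuclideanCLM_fromBlocks_one_neg_one {ι κ : Type*} [Fintype ι] [Fintype κ]
    [DecidableEq ι] [DecidableEq κ] (v : EuclideanSpace ℝ (ι ⊕ κ)) :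
    ‖Matrix.toEuclideanCLM (𝕜 := ℝ) (Matrix.fromBlocks 1 0 0 (-1) : Matrix (ι ⊕ κ) (ι ⊕ κ) ℝ) v‖ =
      ‖v‖ := by
  simp [EuclideanSpace.norm_eq, Matrix.ofLp_toEuclideanCLM, Matrix.fromBlocks_mulVec,
    Matrix.neg_mulVec]

/-- Iterative refinement with the regularized matrix `Kᵉ = K + εJ`,
`J = diag(Iₙ, -Iₘ)`, starting from `z₀ = (Kᵉ)⁻¹ r` and iterating
`z_{i+1} = z_i + (Kᵉ)⁻¹ (r - K z_i)`, converges geometrically: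
`‖z_N - K⁻¹ r‖₂ ≤ (ε ‖(Kᵉ)⁻¹‖)^(N+1) ‖K⁻¹ r‖₂` where `‖·‖` is the operator
norm induced by the Euclidean norm; in particular if `ε ‖(Kᵉ)⁻¹‖ < 1` then
`z_i → K⁻¹ r`. -/
theorem iterative_refinement_convergence {n m : ℕ}
    (K J Kε : Matrix (Fin n ⊕ Fin m) (Fin n ⊕ Fin m) ℝ)
    (hKsymm : K.IsSymm) (hK : IsUnit K)
    (hJ : J = Matrix.fromBlocks 1 0 0 (-1))
    (ε : ℝ) (hε : 0 < ε)
    (hKε : Kε = K + ε • J) (hKεunit : IsUnit Kε)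
    (r : EuclideanSpace ℝ (Fin n ⊕ Fin m))
    (z : ℕ → EuclideanSpace ℝ (Fin n ⊕ Fin m))
    (hz0 : z 0 = Matrix.toEuclideanCLM (𝕜 := ℝ) Kε⁻¹ r)
    (hzrec : ∀ i : ℕ, z (i + 1) = z i + Matrix.toEuclideanCLM (𝕜 := ℝ) Kε⁻¹
        (r - Matrix.toEuclideanCLM (𝕜 := ℝ) K (z i))) :
    (∀ Nref : ℕ,
      ‖z Nref - Matrix.toEuclideanCLM (𝕜 := ℝ) K⁻¹ r‖ ≤
        (ε * ‖Matrix.toEuclideanCLM (𝕜 := ℝ) Kε⁻¹‖) ^ (Nref + 1) *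
          ‖Matrix.toEuclideanCLM (𝕜 := ℝ) K⁻¹ r‖) ∧
    (ε * ‖Matrix.toEuclideanCLM (𝕜 := ℝ) Kε⁻¹‖ < 1 →
      Tendsto z atTop (nhds (Matrix.toEuclideanCLM (𝕜 := ℝ) K⁻¹ r))) := by
  set A := Matrix.toEuclideanCLM (𝕜 := ℝ) K
  set P := Matrix.toEuclideanCLM (𝕜 := ℝ) Kε⁻¹
  set x := Matrix.toEuclideanCLM (𝕜 := ℝ) K⁻¹ r with hx
  have hAx : A x = r := by
    rw [hx, ← mul_apply_eq_comp, ← map_mul,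
      Matrix.mul_nonsing_inv _ ((Matrix.isUnit_iff_isUnit_det K).1 hK), map_one,
      one_apply_eq_self]
  have hP : P * (A + ε • Matrix.toEuclideanCLM (𝕜 := ℝ) J) = 1 := by
    rw [← map_smul, ← map_add, ← hKε, ← map_mul,
      Matrix.nonsing_inv_mul _ ((Matrix.isUnit_iff_isUnit_det Kε).1 hKεunit), map_one]
  have hstep := norm_sub_apply_apply_le hε.le
    (fun v => by rw [hJ]; exact (norm_toEuclideanCLM_fromBlocks_one_neg_one v).le) hP
  have hbound : ∀ k : ℕ, ‖z k - x‖ ≤ (ε * ‖P‖) ^ (k + 1) * ‖x‖ := by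
    intro k
    induction k with
    | zero =>
      rw [hz0, ← hAx, norm_sub_rev, zero_add, pow_one]
      exact hstep x
    | succ k ih =>
      have herr : z (k + 1) - x = (z k - x) - P (A (z k - x)) := by
        rw [hzrec, ← hAx, map_sub A, map_sub P, map_sub P]
        abel
      calc ‖z (k + 1) - x‖ ≤ ε * ‖P‖ * ‖z k - x‖ := herr ▸ hstep _
        _ ≤ ε * ‖P‖ * ((ε * ‖P‖) ^ (k + 1) * ‖x‖) := by gcongr
        _ = (ε * ‖P‖) ^ (k + 1 + 1) * ‖x‖ := by ring
  refine ⟨hbound, fun hlt => tendsto_iff_norm_sub_tendsto_zero.2 ?_⟩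
  refine squeeze_zero (fun _ => norm_nonneg _) hbound ?_
  have hpow := tendsto_pow_atTop_nhds_zero_of_lt_one (by positivity : 0 ≤ ε * ‖P‖) hlt
  simpa using ((tendsto_add_atTop_iff_nat 1).2 hpow).mul_const ‖x‖
end

section
/- KKT necessity for equality-constrained convex quadratic programs: let P ∈ ℝ^{n×n} be symmetric positive semidefinite, q ∈ ℝ^n, A ∈ ℝ^{m×n}, b ∈ ℝ^m. If x̃ ∈ ℝ^n minimizes (1/2)xᵀPx + qᵀx over {x ∈ ℝ^n : Ax = b}, then there exists ỹ ∈ ℝ^m such that P x̃ + Aᵀ ỹ = −q and A x̃ = b; i.e., (x̃, ỹ) solves the KKT system [[P, Aᵀ],[A, 0]] (x̃, ỹ) = (−q, b). -/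
open Matrix

/-- A vector orthogonal to the kernel of a matrix lies in the range of its transpose. -/
theorem exists_transpose_mulVec_eq_of_dotProduct_eq_zero {K ι κ : Type*} [Field K]
    [Fintype ι] [Fintype κ] (A : Matrix κ ι K) (v : ι → K)
    (hv : ∀ d, A *ᵥ d = 0 → v ⬝ᵥ d = 0) : ∃ y, Aᵀ *ᵥ y = v := by
  classical
  have hmem : dotProductEquiv K ι v ∈ LinearMap.range A.mulVecLin.dualMap := by
    rw [LinearMap.range_dualMap_eq_dualAnnihilator_ker, Submodule.mem_dualAnnihilator]
    intro d hd
    exact hv d (by simpa using hd)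
  obtain ⟨ψ, hψ⟩ := hmem
  obtain ⟨y, rfl⟩ := (dotProductEquiv K κ).surjective ψ
  refine ⟨y, dotProduct_eq _ _ fun d => ?_⟩
  have hd : y ⬝ᵥ (A *ᵥ d) = v ⬝ᵥ d := LinearMap.congr_fun hψ d
  rw [mulVec_transpose, ← dotProduct_mulVec, hd]

/-- Expansion of a quadratic objective with symmetric matrix along a line. -/
theorem Matrix.IsSymm.quadratic_add_smul {ι : Type*} [Fintype ι] {P : Matrix ι ι ℝ}
    (hP : P.IsSymm) (q x d : ι → ℝ) (t : ℝ) :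
    (1 / 2) * ((x + t • d) ⬝ᵥ (P *ᵥ (x + t • d))) + q ⬝ᵥ (x + t • d) =
      (1 / 2) * (x ⬝ᵥ (P *ᵥ x)) + q ⬝ᵥ x +
        ((1 / 2) * (d ⬝ᵥ (P *ᵥ d)) * (t * t) + (P *ᵥ x + q) ⬝ᵥ d * t) := by
  have hsymm : x ⬝ᵥ (P *ᵥ d) = d ⬝ᵥ (P *ᵥ x) := by
    rw [dotProduct_mulVec, ← mulVec_transpose, hP.eq, dotProduct_comm]
  simp only [mulVec_add, mulVec_smul, dotProduct_add, add_dotProduct, dotProduct_smul,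
    smul_dotProduct, smul_eq_mul, hsymm, dotProduct_comm (P *ᵥ x) d]
  ring

/-- KKT necessity for equality-constrained convex quadratic programs: if `x̃`
minimizes `(1/2) xᵀ P x + qᵀ x` over `{x | A x = b}` (with `P` symmetric
positive semidefinite), then there is a multiplier `ỹ` with
`P x̃ + Aᵀ ỹ = -q` and `A x̃ = b`. -/
theorem kkt_necessity_equality_qp {n m : ℕ}
    (P : Matrix (Fin n) (Fin n) ℝ) (q : Fin n → ℝ)
    (A : Matrix (Fin m) (Fin n) ℝ) (b : Fin m → ℝ)
    (hP : P.PosSemidef) (xt : Fin n → ℝ)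
    (hfeas : A *ᵥ xt = b)
    (hmin : ∀ z : Fin n → ℝ, A *ᵥ z = b →
      (1 / 2) * (xt ⬝ᵥ (P *ᵥ xt)) + q ⬝ᵥ xt ≤
        (1 / 2) * (z ⬝ᵥ (P *ᵥ z)) + q ⬝ᵥ z) :
    ∃ yt : Fin m → ℝ, P *ᵥ xt + Aᵀ *ᵥ yt = -q ∧ A *ᵥ xt = b := by
  have hsymm : P.IsSymm := by simpa [IsHermitian, IsSymm] using hP.isHermitian
  have horth : ∀ d, A *ᵥ d = 0 → (P *ᵥ xt + q) ⬝ᵥ d = 0 := by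
    intro d hd
    have hdisc := discrim_le_zero (a := (1 / 2) * (d ⬝ᵥ (P *ᵥ d)))
      (b := (P *ᵥ xt + q) ⬝ᵥ d) (c := 0) fun t => by
        have hle := hmin (xt + t • d) (by simp [mulVec_add, mulVec_smul, hd, hfeas])
        rw [hsymm.quadratic_add_smul] at hle
        linarith
    rw [discrim, mul_zero, sub_zero] at hdisc
    exact sq_nonpos_iff _ |>.mp hdisc
  obtain ⟨y, hy⟩ := exists_transpose_mulVec_eq_of_dotProduct_eq_zero A _ horth
  refine ⟨-y, ?_, hfeas⟩
  rw [mulVec_neg, hy]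
  abel
end

section
/- Correctness of the backward (adjoint) gradient formulas for argmin differentiation of a quadratic program: let P ∈ ℝ^{n×n} be symmetric, A ∈ ℝ^{m×n}, and suppose the KKT matrix K = [[P, Aᵀ],[A, 0]] is invertible. Fix x ∈ ℝ^n and y ∈ ℝ^m. Given an incoming gradient Δx̃ ∈ ℝ^n, define (d_x, d_y) = K⁻¹(Δx̃, 0), and set ΔP = −(1/2)(d_x xᵀ + x d_xᵀ), Δq = −d_x, ΔA = −(d_y xᵀ + y d_xᵀ), Δb = d_y. Then for every symmetric dP ∈ ℝ^{n×n}, every dq ∈ ℝ^n, dA ∈ ℝ^{m×n}, db ∈ ℝ^m, if (dx, dy) = K⁻¹(−dP x − dAᵀ y − dq, −dA x + db) is the corresponding directional derivative of the KKT solution, then Δx̃ᵀ dx = tr(ΔPᵀ dP) + Δqᵀ dq + tr(ΔAᵀ dA) + Δbᵀ db. -/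
open Matrix

theorem trace_transpose_vecMulVec_mul {m n R : Type*} [Fintype m] [Fintype n] [CommSemiring R]
    (u : m → R) (v : n → R) (M : Matrix m n R) :
    ((vecMulVec u v)ᵀ * M).trace = u ⬝ᵥ M *ᵥ v := by
  rw [transpose_vecMulVec, vecMulVec_mul, trace_vecMulVec, dotProduct_comm, dotProduct_mulVec]

theorem dotProduct_transpose_mulVec_comm {m n R : Type*} [Fintype m] [Fintype n] [CommSemiring R]
    (M : Matrix m n R) (u : n → R) (v : m → R) :
    u ⬝ᵥ Mᵀ *ᵥ v = v ⬝ᵥ M *ᵥ u := by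
  rw [mulVec_transpose, dotProduct_comm, dotProduct_mulVec]

theorem isSymm_fromBlocks_transpose_zero {m n R : Type*} [Zero R]
    {P : Matrix n n R} (hP : P.IsSymm) (A : Matrix m n R) :
    (fromBlocks P Aᵀ A 0).IsSymm :=
  hP.fromBlocks (transpose_transpose A) isSymm_zero

theorem dotProduct_eq_sum_comp {m n R : Type*} [Fintype m] [Fintype n] [CommSemiring R]
    (d : n ⊕ m → R) (u : n → R) (v : m → R) :
    d ⬝ᵥ Sum.elim u v = (d ∘ Sum.inl) ⬝ᵥ u + (d ∘ Sum.inr) ⬝ᵥ v := by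
  simp [dotProduct]

/-- Correctness of the backward (adjoint) gradient formulas for argmin
differentiation of a quadratic program: with `K = [[P, Aᵀ],[A, 0]]` invertible
and `P` symmetric, `(d_x, d_y) = K⁻¹ (Δx̃, 0)`, and
`ΔP = -(1/2)(d_x xᵀ + x d_xᵀ)`, `Δq = -d_x`, `ΔA = -(d_y xᵀ + y d_xᵀ)`,
`Δb = d_y`, it holds for every symmetric `dP` and arbitrary `dq, dA, db` that
the directional derivative `(dx, dy) = K⁻¹(-dP x - dAᵀ y - dq, -dA x + db)`
satisfies `Δx̃ᵀ dx = tr(ΔPᵀ dP) + Δqᵀ dq + tr(ΔAᵀ dA) + Δbᵀ db`. -/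
theorem backward_gradient_formulas {n m : ℕ}
    (P : Matrix (Fin n) (Fin n) ℝ) (A : Matrix (Fin m) (Fin n) ℝ)
    (hPsymm : P.IsSymm)
    (hK : IsUnit (Matrix.fromBlocks P Aᵀ A 0))
    (x : Fin n → ℝ) (y : Fin m → ℝ) (Δx : Fin n → ℝ)
    (d : Fin n ⊕ Fin m → ℝ)
    (hd : d = (Matrix.fromBlocks P Aᵀ A 0)⁻¹ *ᵥ Sum.elim Δx 0)
    (ΔP : Matrix (Fin n) (Fin n) ℝ) (Δq : Fin n → ℝ)
    (ΔA : Matrix (Fin m) (Fin n) ℝ) (Δb : Fin m → ℝ)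
    (hΔP : ΔP = -((1 / 2 : ℝ) •
      (vecMulVec (d ∘ Sum.inl) x + vecMulVec x (d ∘ Sum.inl))))
    (hΔq : Δq = -(d ∘ Sum.inl))
    (hΔA : ΔA = -(vecMulVec (d ∘ Sum.inr) x + vecMulVec y (d ∘ Sum.inl)))
    (hΔb : Δb = d ∘ Sum.inr) :
    ∀ (dP : Matrix (Fin n) (Fin n) ℝ), dP.IsSymm →
      ∀ (dq : Fin n → ℝ) (dA : Matrix (Fin m) (Fin n) ℝ) (db : Fin m → ℝ)
        (dz : Fin n ⊕ Fin m → ℝ),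
        dz = (Matrix.fromBlocks P Aᵀ A 0)⁻¹ *ᵥ
          Sum.elim (-(dP *ᵥ x) - dAᵀ *ᵥ y - dq) (-(dA *ᵥ x) + db) →
        Δx ⬝ᵥ (dz ∘ Sum.inl) =
          (ΔPᵀ * dP).trace + Δq ⬝ᵥ dq + (ΔAᵀ * dA).trace + Δb ⬝ᵥ db := by
  intro dP hdP dq dA db dz hdz
  have hinv : (fromBlocks P Aᵀ A 0)⁻¹ᵀ = (fromBlocks P Aᵀ A 0)⁻¹ := by
    rw [transpose_nonsing_inv, (isSymm_fromBlocks_transpose_zero hPsymm A).eq]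
  have adjoint : Δx ⬝ᵥ (dz ∘ Sum.inl) =
      d ⬝ᵥ Sum.elim (-(dP *ᵥ x) - dAᵀ *ᵥ y - dq) (-(dA *ᵥ x) + db) := by
    have h : Δx ⬝ᵥ (dz ∘ Sum.inl) = dz ⬝ᵥ Sum.elim Δx 0 := by
      rw [dotProduct_eq_sum_comp, dotProduct_zero, add_zero, dotProduct_comm]
    rw [h, dotProduct_comm, hdz, hd, ← dotProduct_transpose_mulVec_comm, hinv, dotProduct_comm]
  have hsymm : x ⬝ᵥ dP *ᵥ (d ∘ Sum.inl) = (d ∘ Sum.inl) ⬝ᵥ dP *ᵥ x := by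
    rw [← dotProduct_transpose_mulVec_comm, hdP.eq]
  rw [adjoint, dotProduct_eq_sum_comp, hΔP, hΔq, hΔA, hΔb]
  simp only [transpose_neg, transpose_smul, transpose_add, Matrix.neg_mul, Matrix.smul_mul,
    Matrix.add_mul, trace_neg, trace_smul, trace_add, trace_transpose_vecMulVec_mul, hsymm,
    dotProduct_sub, dotProduct_add, dotProduct_neg, neg_dotProduct,
    dotProduct_transpose_mulVec_comm, smul_eq_mul]
  ring
end
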